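/- arXiv:1211.3534 — 5 statements merged into one kernel-verified Lean document; each statement's English description precedes it below -/
import Mathlib

section
/- An orientation preserving homeomorphism h of the plane ℝ² without fixed points has no periodic points: for every x ∈ ℝ² and every integer n ≥ 1, hⁿ(x) ≠ x. -/
open Set

/-- `θ` is a continuous argument lift on `[a, b]` of the (nonvanishing) vector field `v`:
`v t = ‖v t‖ · exp(2πi·θ t)` for all `t ∈ [a, b]`. -/
def IsArgLift (v : ℝ → ℂ) (a b : ℝ) (θ : ℝ → ℝ) : Prop :=
  ContinuousOn θ (Set.Icc a b) ∧
    ∀ t ∈ Set.Icc a b,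
      v t = (‖v t‖ : ℂ) * Complex.exp (2 * Real.pi * Complex.I * θ t)

/-- The index of the map `f` along the path `α : [a, b] → ℂ` equals `c`:
every continuous argument lift `θ` of `t ↦ f (α t) - α t` satisfies `θ b - θ a = c`. -/
def HasIndex (f : ℂ → ℂ) (α : ℝ → ℂ) (a b : ℝ) (c : ℝ) : Prop :=
  ∀ θ : ℝ → ℝ, IsArgLift (fun t => f (α t) - α t) a b θ → θ b - θ a = c

/-- A simple closed curve parametrized on `[a, b]`. -/
def IsSimpleClosedCurve (α : ℝ → ℂ) (a b : ℝ) : Prop :=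
  a < b ∧ ContinuousOn α (Set.Icc a b) ∧ α a = α b ∧ Set.InjOn α (Set.Ico a b)

/-- An arc (injective continuous path) parametrized on `[a, b]`. -/
def IsArcOn (α : ℝ → ℂ) (a b : ℝ) : Prop :=
  a < b ∧ ContinuousOn α (Set.Icc a b) ∧ Set.InjOn α (Set.Icc a b)

/-- `I` is the interior (the bounded complementary component) of the Jordan curve `C`. -/
def IsInteriorOf (C I : Set ℂ) : Prop :=
  Bornology.IsBounded I ∧ ∃ x ∈ Cᶜ, I = connectedComponentIn Cᶜ x

/-- `E` is the exterior (the unbounded complementary component) of the Jordan curve `C`. -/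
def IsExteriorOf (C E : Set ℂ) : Prop :=
  ¬ Bornology.IsBounded E ∧ ∃ x ∈ Cᶜ, E = connectedComponentIn Cᶜ x

/-- A simple closed curve is positively oriented (its interior lies on its left) iff it has
winding number `+1` around every point of its interior. -/
def IsPositivelyOriented (α : ℝ → ℂ) (a b : ℝ) : Prop :=
  ∀ I : Set ℂ, IsInteriorOf (α '' Set.Icc a b) I → ∀ z ∈ I,
    ∀ θ : ℝ → ℝ, IsArgLift (fun t => α t - z) a b θ → θ b - θ a = 1

/-- A homeomorphism of the plane is orientation preserving iff it is isotopic to the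
identity through homeomorphisms. -/
def OrientationPreserving (h : ℂ ≃ₜ ℂ) : Prop :=
  ∃ H : ℝ → ℂ → ℂ, Continuous (fun p : ℝ × ℂ => H p.1 p.2) ∧
    (∀ t ∈ Set.Icc (0 : ℝ) 1, IsHomeomorph (H t)) ∧ H 0 = id ∧ H 1 = ⇑h

/-- `F` is compactly connected: any two points of `F` lie in a common subcontinuum of `F`. -/
def CompactlyConnected (F : Set ℂ) : Prop :=
  ∀ x ∈ F, ∀ y ∈ F, ∃ K : Set ℂ, K ⊆ F ∧ x ∈ K ∧ y ∈ K ∧ IsCompact K ∧ IsConnected K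

/-- The open subarc of the closed curve `α : [a,b] → ℂ` (with `α a = α b`) traversed in the
positive direction from parameter `u` to parameter `v`. -/
def cyclicOpenArc (α : ℝ → ℂ) (a b u v : ℝ) : Set ℂ :=
  if u ≤ v then α '' Set.Ioo u v else α '' Set.Ioc u b ∪ α '' Set.Ioo a v

/-! ### Continuous logarithms -/

theorem exp_lift_sub_eq {A : Type*} [TopologicalSpace A] [PreconnectedSpace A] {F G : A → ℂ}
    (hF : Continuous F) (hG : Continuous G) (hFG : ∀ a, Complex.exp (F a) = Complex.exp (G a))
    (a b : A) : F a - G a = F b - G b := by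
  have key : F = fun x => G x + (F a - G a) := by
    refine Complex.isCoveringMap_exp.eq_of_comp_eq hF (by fun_prop) ?_ a (by ring)
    funext x
    simp [Complex.exp_add, Complex.exp_sub, hFG]
  have := congrFun key b
  linear_combination -this

theorem exists_continuous_log {A : Type*} [TopologicalSpace A] [SimplyConnectedSpace A]
    [LocallyPathConnectedSpace A] {f : A → ℂ} (hf : Continuous f) (h0 : ∀ a, f a ≠ 0) :
    ∃ F : A → ℂ, Continuous F ∧ ∀ a, Complex.exp (F a) = f a := by
  obtain ⟨a₀⟩ := (inferInstance : Nonempty A)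
  obtain ⟨F, ⟨-, hF⟩, -⟩ := Complex.isCoveringMapOn_exp.existsUnique_continuousMap_lifts
    (⟨f, hf⟩ : C(A, ℂ)) (a₀ := a₀) (e₀ := Complex.log (f a₀)) (Complex.exp_log (h0 a₀))
    (fun a => h0 a)
  exact ⟨F, F.continuous, fun a => congrFun hF a⟩

/-! ### Points of period two -/

/-- Along an isotopy `H` from the identity to `h`, the displacement `H t (h p) - H t p` never
vanishes; comparing its continuous logarithm at `t = 0` and `t = 1` rules out cycles of length two. -/
theorem apply_apply_ne_of_fixed_point_free {h : ℂ ≃ₜ ℂ} (hor : OrientationPreserving h)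
    (hfix : ∀ x : ℂ, h x ≠ x) (x : ℂ) : h (h x) ≠ x := by
  intro hx
  obtain ⟨H, hc, hH, h0, h1⟩ := hor
  let π : ℝ → ℝ := fun t => projIcc (0 : ℝ) 1 zero_le_one t
  have hπ : Continuous π := continuous_subtype_val.comp continuous_projIcc
  have hπm : ∀ t, π t ∈ Icc (0 : ℝ) 1 := fun t => (projIcc (0 : ℝ) 1 zero_le_one t).2
  have hπ0 : π 0 = 0 := by simp [π]
  have hπ1 : π 1 = 1 := by simp [π]
  let M : ℂ × ℝ → ℂ := fun p => H (π p.2) (h p.1) - H (π p.2) p.1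
  have hMc : Continuous M :=
    (hc.comp (f := fun p : ℂ × ℝ => (π p.2, h p.1)) (by fun_prop)).sub
      (hc.comp (f := fun p : ℂ × ℝ => (π p.2, p.1)) (by fun_prop))
  have hM0 : ∀ p, M p ≠ 0 := fun p hp =>
    hfix p.1 ((hH _ (hπm p.2)).injective (sub_eq_zero.mp hp))
  obtain ⟨m, hm, hexp⟩ := exists_continuous_log hMc hM0
  have hA := exp_lift_sub_eq (F := fun t : ℝ => m (h x, t))
    (G := fun t : ℝ => m (x, t) + Real.pi * Complex.I) (by fun_prop) (by fun_prop)
    (fun t => by simp [Complex.exp_add, hexp, M, hx]) 0 1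
  have hB := exp_lift_sub_eq (F := fun p : ℂ => m (p, 1)) (G := fun p : ℂ => m (h p, 0))
    (by fun_prop) (by fun_prop)
    (fun p => by simp [hexp, M, hπ0, hπ1, h0, h1]) x (h x)
  simp only [hx] at hA hB
  have hm0 : m (h x, 0) = m (x, 0) := by linear_combination (hA - hB) / 2
  have hM : M (h x, 0) = M (x, 0) := by rw [← hexp, ← hexp, hm0]
  simp only [M, hπ0, h0, id, hx] at hM
  exact hfix x (by linear_combination (-1 / 2 : ℂ) * hM)

/-! ### Isotopies supported in an open set -/

theorem OrientationPreserving.refl : OrientationPreserving (Homeomorph.refl ℂ) :=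
  ⟨fun _ => id, continuous_snd, fun _ _ => (Homeomorph.refl ℂ).isHomeomorph, rfl, rfl⟩

theorem OrientationPreserving.trans {f g : ℂ ≃ₜ ℂ} (hf : OrientationPreserving f)
    (hg : OrientationPreserving g) : OrientationPreserving (f.trans g) := by
  obtain ⟨F, hF, hFh, hF0, hF1⟩ := hf
  obtain ⟨G, hG, hGh, hG0, hG1⟩ := hg
  refine ⟨fun t => G t ∘ F t, ?_, fun t ht => (hGh t ht).comp (hFh t ht), by simp [hF0, hG0],
    by
      funext w; simp [hF1, hG1]⟩
  exact hG.comp (f := fun p : ℝ × ℂ => (p.1, F p.1 p.2)) (continuous_fst.prodMk hF)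

theorem isHomeomorph_add_of_lipschitz {g : ℂ → ℂ} {c : NNReal} (hg : LipschitzWith c g)
    (hc : c < 1) : IsHomeomorph (fun w => w + g w) := by
  have happ : ApproximatesLinearOn (fun w => w + g w)
      ((ContinuousLinearEquiv.refl ℝ ℂ : ℂ ≃L[ℝ] ℂ) : ℂ →L[ℝ] ℂ) univ c := by
    intro x _ y _
    have hxy : x + g x - (y + g y) - (x - y) = g x - g y := by ring
    have := hg.dist_le_mul x y
    rw [dist_eq_norm, dist_eq_norm, ← hxy] at this
    exact this
  exact (happ.toHomeomorph _ (Or.inr (by simpa using hc))).isHomeomorph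

/-- Inside a ball contained in `V`, the centre can be moved to any point by an isotopy
supported in `V`. -/
theorem exists_push_ball {V : Set ℂ} {c q : ℂ} {r : ℝ} (hV : Metric.ball c r ⊆ V)
    (hq : q ∈ Metric.ball c r) :
    ∃ φ : ℂ ≃ₜ ℂ, OrientationPreserving φ ∧ φ c = q ∧ ∀ w ∉ V, φ w = w := by
  have hqr : ‖q - c‖ < r := by simpa [dist_eq_norm] using hq
  have hr : 0 < r := (norm_nonneg _).trans_lt hqr
  let ρ : ℂ → ℝ := fun w => max 0 (1 - dist w c / r)
  have hρ : ∀ w w', |ρ w - ρ w'| ≤ dist w w' / r := by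
    intro w w'
    refine (abs_max_sub_max_le_max _ _ _ _).trans ?_
    rw [sub_self, abs_zero, max_eq_right (abs_nonneg _)]
    have : 1 - dist w c / r - (1 - dist w' c / r) = -((dist w c - dist w' c) / r) := by ring
    rw [this, abs_neg, abs_div, abs_of_pos hr]
    gcongr
    exact abs_dist_sub_le w w' c
  let g : ℝ → ℂ → ℂ := fun t w => ((t * ρ w : ℝ) : ℂ) * (q - c)
  have hhom : ∀ t ∈ Icc (0 : ℝ) 1, IsHomeomorph (fun w => w + g t w) := by
    intro t ht
    refine isHomeomorph_add_of_lipschitz (c := (‖q - c‖ / r).toNNReal) ?_ ?_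
    · refine LipschitzWith.of_dist_le_mul fun w w' => ?_
      have : g t w - g t w' = ((t * (ρ w - ρ w') : ℝ) : ℂ) * (q - c) := by
        simp only [g]; push_cast; ring
      rw [Real.coe_toNNReal _ (by positivity), dist_eq_norm, this, norm_mul, Complex.norm_real, Real.norm_eq_abs, abs_mul,
        abs_of_nonneg ht.1]
      calc t * |ρ w - ρ w'| * ‖q - c‖ ≤ 1 * (dist w w' / r) * ‖q - c‖ := by
            gcongr
            exacts [ht.2, hρ w w']
        _ = ‖q - c‖ / r * dist w w' := by ring
    · rw [Real.toNNReal_lt_one]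
      exact (div_lt_one hr).mpr hqr
  have hρc : Continuous ρ := by fun_prop
  refine ⟨(hhom 1 (by simp)).homeomorph, ⟨fun t w => w + g t w, ?_, hhom, ?_, rfl⟩, ?_, ?_⟩
  · fun_prop
  · funext w; simp [g]
  · simp [g, ρ]
  · intro w hw
    have : r ≤ dist w c := by
      by_contra! hlt
      exact hw (hV hlt)
    have hρ0 : ρ w = 0 := max_eq_left (by rw [sub_nonpos]; exact (one_le_div hr).mpr this)
    simp [g, hρ0]

theorem exists_push {K V : Set ℂ} (hK : IsPreconnected K) (hV : IsOpen V) (hKV : K ⊆ V)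
    {a b : ℂ} (ha : a ∈ K) (hb : b ∈ K) :
    ∃ φ : ℂ ≃ₜ ℂ, OrientationPreserving φ ∧ φ a = b ∧ ∀ w ∉ V, φ w = w := by
  let S : Set ℂ := {c | ∃ φ : ℂ ≃ₜ ℂ, OrientationPreserving φ ∧ φ a = c ∧ ∀ w ∉ V, φ w = w}
  have step : ∀ {c q : ℂ} {r : ℝ}, Metric.ball c r ⊆ V → q ∈ Metric.ball c r → c ∈ S → q ∈ S := by
    rintro c q r hr hq ⟨φ, hφ, hφa, hφV⟩
    obtain ⟨ψ, hψ, hψc, hψV⟩ := exists_push_ball hr hq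
    refine ⟨φ.trans ψ, hφ.trans hψ, by simp [hφa, hψc], fun w hw => ?_⟩
    simp [hφV w hw, hψV w hw]
  have hS : IsOpen (V ∩ S) := by
    refine Metric.isOpen_iff.mpr fun c hc => ?_
    obtain ⟨r, hr, hrV⟩ := Metric.isOpen_iff.mp hV c hc.1
    exact ⟨r, hr, fun q hq => ⟨hrV hq, step hrV hq hc.2⟩⟩
  have hS' : IsOpen (V \ S) := by
    refine Metric.isOpen_iff.mpr fun c hc => ?_
    obtain ⟨r, hr, hrV⟩ := Metric.isOpen_iff.mp hV c hc.1
    refine ⟨r / 2, by positivity, fun q hq => ⟨hrV (Metric.ball_subset_ball (by linarith) hq),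
      fun hqS => hc.2 ?_⟩⟩
    rw [Metric.mem_ball] at hq
    refine step (r := r / 2) (fun w hw => hrV ?_) (Metric.mem_ball'.mpr hq) hqS
    rw [Metric.mem_ball] at hw ⊢
    linarith [dist_triangle w q c]
  by_contra hbS
  obtain ⟨w, -, hw, hw'⟩ := hK (V ∩ S) (V \ S) hS hS'
    (fun w hw => by simp [hKV hw])
    ⟨a, ha, hKV ha, Homeomorph.refl ℂ, .refl, rfl, fun _ _ => rfl⟩ ⟨b, hb, hKV hb, hbS⟩
  exact hw'.2 hw.2

/-! ### Modifying a map near a free compact set -/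

/-- If `K` is a continuum disjoint from its image under `h`, then `h` can be followed by a
homeomorphism moving `a ∈ K` to `b ∈ K`, without creating fixed points and without moving the
points of a given closed set `C` disjoint from `K`. -/
theorem exists_free_push {h : ℂ ≃ₜ ℂ} (hor : OrientationPreserving h) (hfix : ∀ x, h x ≠ x)
    {K C : Set ℂ} (hK : IsPreconnected K) (hKc : IsCompact K) (hfree : ∀ p ∈ K, h p ∉ K)
    (hC : IsClosed C) (hKC : Disjoint K C) {a b : ℂ} (ha : a ∈ K) (hb : b ∈ K) :
    ∃ φ : ℂ ≃ₜ ℂ, OrientationPreserving (h.trans φ) ∧ (∀ x, h.trans φ x ≠ x) ∧ φ a = b ∧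
      ∀ w ∈ C, φ w = w := by
  have hdisj : Disjoint K (h '' K) := by
    rw [Set.disjoint_left]
    rintro _ hp ⟨p, hpK, rfl⟩
    exact hfree p hpK hp
  obtain ⟨U, W, hU, hW, hKU, hKW, hUW⟩ :=
    SeparatedNhds.of_isCompact_isCompact hKc (hKc.image h.continuous) hdisj
  have hVo : IsOpen (U ∩ h ⁻¹' W ∩ Cᶜ) := (hU.inter (hW.preimage h.continuous)).inter
    hC.isOpen_compl
  obtain ⟨φ, hφ, hφa, hφV⟩ := exists_push hK hVo
    (fun p hp => ⟨⟨hKU hp, hKW ⟨p, hp, rfl⟩⟩, Set.disjoint_left.mp hKC hp⟩) ha hb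
  refine ⟨φ, hor.trans hφ, fun p hp => ?_, hφa, fun w hw => hφV w fun hwV => hwV.2 hw⟩
  rw [Homeomorph.trans_apply] at hp
  by_cases hV : h p ∈ U ∩ h ⁻¹' W ∩ Cᶜ
  · have hpV : p ∈ U ∩ h ⁻¹' W ∩ Cᶜ := by
      by_contra hpV
      have : h p = p := φ.injective (hp.trans (hφV p hpV).symm)
      exact hpV (this ▸ hV)
    exact Set.disjoint_left.mp hUW hV.1.1 hpV.1.2
  · exact hfix p ((hφV _ hV).symm.trans hp)

/-- `HasFreePeriodicMap n`: some fixed point free orientation preserving homeomorphism of the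
plane has a point fixed by its `n`-th iterate. -/
def HasFreePeriodicMap (n : ℕ) : Prop :=
  ∃ h : ℂ ≃ₜ ℂ, OrientationPreserving h ∧ (∀ x, h x ≠ x) ∧ ∃ x, (⇑h)^[n] x = x

/-- If a continuum disjoint from its image contains `a` and `h^[k] a`, the orbit of `a` can be
closed up. -/
theorem exists_hasFreePeriodicMap_of_return {h : ℂ ≃ₜ ℂ} (hor : OrientationPreserving h)
    (hfix : ∀ x, h x ≠ x) {K : Set ℂ} (hK : IsPreconnected K) (hKc : IsCompact K)
    (hfree : ∀ p ∈ K, h p ∉ K) {a : ℂ} {k : ℕ} (hk : 1 ≤ k) (ha : a ∈ K)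
    (hka : (⇑h)^[k] a ∈ K) : ∃ m, 1 ≤ m ∧ m ≤ k ∧ HasFreePeriodicMap m := by
  classical
  have hex : ∃ m, 1 ≤ m ∧ (⇑h)^[m] a ∈ K := ⟨k, hk, hka⟩
  obtain ⟨hm1, hmK⟩ := Nat.find_spec hex
  set m := Nat.find hex
  have hmin : ∀ j, 1 ≤ j → j < m → (⇑h)^[j] a ∉ K := fun j hj hjm hjK =>
    Nat.find_min hex hjm ⟨hj, hjK⟩
  obtain ⟨φ, hφ, hφfix, hφa, hφC⟩ := exists_free_push hor hfix hK hKc hfree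
    (C := (fun j => (⇑h)^[j] a) '' Set.Ico 1 m) ((Set.finite_Ico 1 m).image _).isClosed
    (by
      rw [Set.disjoint_right]
      rintro _ ⟨j, hj, rfl⟩
      exact hmin j hj.1 hj.2) hmK ha
  refine ⟨m, hm1, Nat.find_min' hex ⟨hk, hka⟩, h.trans φ, hφ, hφfix, a, ?_⟩
  have hiter : ∀ j, j < m → (⇑(h.trans φ))^[j] a = (⇑h)^[j] a := by
    intro j
    induction j with
    | zero => simp
    | succ j ih =>
      intro hj
      rw [Function.iterate_succ_apply', ih (by omega), Homeomorph.trans_apply,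
        ← Function.iterate_succ_apply' h]
      exact hφC _ ⟨j + 1, ⟨by omega, hj⟩, rfl⟩
  obtain ⟨l, hl⟩ : ∃ l, m = l + 1 := ⟨m - 1, by omega⟩
  rw [hl, Function.iterate_succ_apply', hiter l (by omega), Homeomorph.trans_apply,
    ← Function.iterate_succ_apply' h]
  rw [hl] at hφa
  exact hφa

/-! ### Decreasing the period -/

theorem dist_le_and_eq_of_mem_segment {x y w : ℂ} {r : ℝ} (hr : 0 < r) (hy : dist y x ≤ r)
    (hw : w ∈ segment ℝ y x) : dist w x ≤ r ∧ (dist w x = r → w = y) := by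
  obtain ⟨a, b, ha, hb, hab, rfl⟩ := hw
  have hd : dist (a • y + b • x) x = a * dist y x := by
    have : a • y + b • x - x = a • (y - x) := by
      rw [← eq_sub_iff_add_eq'] at hab
      rw [hab, smul_sub, sub_smul, one_smul]; abel
    rw [dist_eq_norm, this, norm_smul, Real.norm_of_nonneg ha, dist_eq_norm]
  rw [hd]
  have ha1 : a ≤ 1 := by linarith
  refine ⟨by nlinarith [dist_nonneg (x := y) (y := x)], fun h => ?_⟩
  have : a = 1 := by nlinarith [dist_nonneg (x := y) (y := x)]
  obtain rfl : b = 0 := by linarith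
  simp [this]

theorem isCompact_segment_complex (x y : ℂ) : IsCompact (segment ℝ x y) := by
  rw [← convexHull_pair]
  exact (Set.toFinite {x, y}).isCompact_convexHull ℝ

/-- The largest free round ball centred at `x`: its closure contains a point `z` of its boundary
sphere together with `h z`, and a point can be mapped from the closed ball to itself only along
the boundary. -/
theorem exists_maximal_free_ball {h : ℂ ≃ₜ ℂ} (hfix : ∀ x, h x ≠ x) (x : ℂ) :
    ∃ r > 0, ∃ z, dist z x = r ∧ dist (h z) x = r ∧
      ∀ p, dist p x ≤ r → dist (h p) x ≤ r → dist p x = r ∧ dist (h p) x = r := by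
  obtain ⟨z, hz⟩ := Continuous.exists_forall_le
    (f := fun p => max (dist p x) (dist (h p) x)) (by fun_prop)
    (Filter.tendsto_atTop_mono (fun p => le_max_left _ _) (tendsto_dist_right_cocompact_atTop x))
  set r := max (dist z x) (dist (h z) x) with hr
  have hr0 : 0 < r := by
    by_contra! hle
    have h1 : dist z x ≤ 0 := (le_max_left _ _).trans hle
    have h2 : dist (h z) x ≤ 0 := (le_max_right _ _).trans hle
    exact hfix z ((dist_le_zero.mp h2).trans (dist_le_zero.mp h1).symm)
  have hball : ∀ q ∈ Metric.ball x r, h q ∉ Metric.ball x r := fun q hq hq' =>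
    absurd (hz q) (not_le.mpr (max_lt hq hq'))
  have hcl : closure (Metric.ball x r) = Metric.closedBall x r := closure_ball x hr0.ne'
  have key : ∀ p, dist p x ≤ r → dist (h p) x ≤ r → dist p x = r ∧ dist (h p) x = r := by
    intro p hp hp'
    refine ⟨hp.antisymm ?_, hp'.antisymm ?_⟩ <;> by_contra! hlt
    · have hmem : h p ∈ closure (Metric.ball x r) := hcl ▸ hp'
      obtain ⟨_, ⟨q, hq, rfl⟩, hq'⟩ := mem_closure_iff.mp hmem (h '' Metric.ball x r)
        (h.isOpenMap _ Metric.isOpen_ball) ⟨p, hlt, rfl⟩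
      exact hball q hq hq'
    · have hmem : p ∈ closure (Metric.ball x r) := hcl ▸ hp
      obtain ⟨q, hq, hq'⟩ := mem_closure_iff.mp hmem (h ⁻¹' Metric.ball x r)
        (Metric.isOpen_ball.preimage h.continuous) hlt
      exact hball q hq' hq
  exact ⟨r, hr0, z, (key z (le_max_left _ _) (le_max_right _ _)).1,
    (key z (le_max_left _ _) (le_max_right _ _)).2, key⟩

/-- With `K` the segment from `z` to `x` and `L` the segment from `h z` to `x`, the orbit of `x` is
shortened by moving `h x` to `h (h x)` in two free steps: along the image of `L` to `h (h z)`, then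
along the second image of `K` to `h (h x)`. -/
theorem HasFreePeriodicMap.exists_lt {n : ℕ} (hn : 3 ≤ n) (hP : HasFreePeriodicMap n) :
    ∃ m, 1 ≤ m ∧ m < n ∧ HasFreePeriodicMap m := by
  by_contra hno
  obtain ⟨h, hor, hfix, x, hx⟩ := hP
  have hret : ∀ {K : Set ℂ}, IsPreconnected K → IsCompact K → (∀ p ∈ K, h p ∉ K) →
      ∀ {a : ℂ} {k : ℕ}, 1 ≤ k → k < n → a ∈ K → (⇑h)^[k] a ∉ K := by
    intro K hK hKc hfree a k hk hkn ha hka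
    obtain ⟨m, hm, hmk, hPm⟩ := exists_hasFreePeriodicMap_of_return hor hfix hK hKc hfree hk ha hka
    exact hno ⟨m, hm, by omega, hPm⟩
  obtain ⟨r, hr, z, hz, hhz, hbd⟩ := exists_maximal_free_ball hfix x
  have hfreeOf : ∀ A : Set ℂ, (∀ p ∈ A, dist p x ≤ r) →
      (∀ p ∈ A, ∀ q ∈ A, dist p x = r → dist q x = r → p = q) → ∀ p ∈ A, h p ∉ A := by
    intro A hA hA' p hp hp'
    obtain ⟨h1, h2⟩ := hbd p (hA _ hp) (hA _ hp')
    exact hfix p (hA' _ hp' _ hp h2 h1)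
  have hseg : ∀ y, dist y x ≤ r → ∀ p ∈ segment ℝ y x, h p ∉ segment ℝ y x := by
    intro y hy
    refine hfreeOf _ (fun p hp => (dist_le_and_eq_of_mem_segment hr hy hp).1) ?_
    intro p hp q hq hp' hq'
    rw [(dist_le_and_eq_of_mem_segment hr hy hp).2 hp',
      (dist_le_and_eq_of_mem_segment hr hy hq).2 hq']
  have hpre : ∀ y, IsPreconnected (segment ℝ y x) := fun y =>
    (convex_segment (𝕜 := ℝ) y x).isPreconnected
  have hcpt : ∀ y, IsCompact (segment ℝ y x) := fun y => isCompact_segment_complex y x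
  set K := segment ℝ z x with hKdef
  set L := segment ℝ (h z) x with hLdef
  have hzK : z ∈ K := left_mem_segment ℝ _ _
  have hxK : x ∈ K := right_mem_segment ℝ _ _
  have hzL : h z ∈ L := left_mem_segment ℝ _ _
  have hxL : x ∈ L := right_mem_segment ℝ _ _
  have hKfree : ∀ p ∈ K, h p ∉ K := hseg z hz.le
  have hLfree : ∀ p ∈ L, h p ∉ L := hseg (h z) hhz.le
  have hKorb : ∀ j, 1 ≤ j → j < n → (⇑h)^[j] x ∉ K := fun j h1 h2 =>
    hret (hpre z) (hcpt z) hKfree h1 h2 hxK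
  have hLorb : ∀ j, 1 ≤ j → j < n → (⇑h)^[j] x ∉ L := fun j h1 h2 =>
    hret (hpre (h z)) (hcpt (h z)) hLfree h1 h2 hxL
  have hKL : ∀ a ∈ K, h (h a) ∉ L := by
    intro a ha hb
    obtain ⟨had, haz⟩ := dist_le_and_eq_of_mem_segment hr hz.le ha
    obtain ⟨hbd', hbz⟩ := dist_le_and_eq_of_mem_segment hr hhz.le hb
    have hne : dist a x = r → dist (h (h a)) x = r → False := by
      intro h1 h2
      have := hbz h2
      rw [haz h1] at this
      exact hfix _ this
    refine hret (K := segment ℝ a x ∪ segment ℝ (h (h a)) x) (a := a) (k := 2)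
      (IsPreconnected.union x (right_mem_segment ℝ _ _) (right_mem_segment ℝ _ _) (hpre _)
        (hpre _)) ((hcpt _).union (hcpt _)) ?_ (by omega) (by omega)
      (Or.inl (left_mem_segment ℝ _ _)) (Or.inr (left_mem_segment ℝ _ _))
    have hA : ∀ p ∈ segment ℝ a x ∪ segment ℝ (h (h a)) x, dist p x ≤ r ∧
        (dist p x = r → p = a ∨ p = h (h a)) := by
      rintro p (hp | hp)
      · have := dist_le_and_eq_of_mem_segment hr had hp
        exact ⟨this.1, fun h => Or.inl (this.2 h)⟩
      · have := dist_le_and_eq_of_mem_segment hr hbd' hp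
        exact ⟨this.1, fun h => Or.inr (this.2 h)⟩
    refine hfreeOf _ (fun p hp => (hA p hp).1) fun p hp q hq hp' hq' => ?_
    rcases (hA p hp).2 hp' with rfl | rfl <;> rcases (hA q hq).2 hq' with rfl | rfl
    exacts [rfl, (hne hp' hq').elim, (hne hq' hp').elim, rfl]
  let C : Set ℂ := (fun j => (⇑h)^[j] x) '' Set.Icc 3 n
  have hC : IsClosed C := ((Set.finite_Icc 3 n).image _).isClosed
  have hCsucc : ∀ p ∈ C, ∃ j, 1 ≤ j ∧ j + 2 ≤ n ∧ p = h (h ((⇑h)^[j] x)) := by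
    rintro _ ⟨j, hj, rfl⟩
    obtain ⟨i, rfl⟩ : ∃ i, j = i + 2 := ⟨j - 2, by have := hj.1; omega⟩
    refine ⟨i, by have := hj.1; omega, hj.2, ?_⟩
    simp only [Function.iterate_succ_apply']
  obtain ⟨φ, hφ, hφfix, hφx, hφC⟩ := exists_free_push (K := h '' L)
    (C := h '' (h '' (h '' K)) ∪ C) (a := h x) (b := h (h z)) hor hfix
    ((hpre _).image _ h.continuous.continuousOn) ((hcpt _).image h.continuous)
    (by
      rintro _ ⟨p, hp, rfl⟩ ⟨q, hq, hqp⟩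
      exact hLfree p hp (h.injective hqp ▸ hq))
    (((((hcpt z).image h.continuous).image h.continuous).image h.continuous).isClosed.union hC)
    (by
      rw [Set.disjoint_left]
      rintro _ ⟨p, hp, rfl⟩ (⟨_, ⟨_, ⟨q, hq, rfl⟩, rfl⟩, hqp⟩ | hpC)
      · exact hKL q hq (h.injective hqp ▸ hp)
      · obtain ⟨j, hj1, hj2, hj⟩ := hCsucc _ hpC
        refine hLorb (j + 1) (by omega) (by omega) ?_
        rw [Function.iterate_succ_apply']
        exact h.injective hj ▸ hp)
    ⟨x, hxL, rfl⟩ ⟨h z, hzL, rfl⟩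
  obtain ⟨ψ, hψ, hψfix, hψx, hψC⟩ := exists_free_push (K := h '' (h '' K))
    (C := C) (a := h (h z)) (b := h (h x)) hφ hφfix
    (((hpre _).image _ h.continuous.continuousOn).image _ h.continuous.continuousOn)
    (((hcpt _).image h.continuous).image h.continuous)
    (by
      rintro _ ⟨_, ⟨p, hp, rfl⟩, rfl⟩ hmem
      rw [Homeomorph.trans_apply, hφC _ (Or.inl ⟨_, ⟨_, ⟨p, hp, rfl⟩, rfl⟩, rfl⟩)] at hmem
      obtain ⟨_, ⟨q, hq, rfl⟩, hqp⟩ := hmem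
      exact hKfree p hp (h.injective (h.injective hqp) ▸ hq))
    hC
    (by
      rw [Set.disjoint_left]
      rintro _ ⟨_, ⟨p, hp, rfl⟩, rfl⟩ hpC
      obtain ⟨j, hj1, hj2, hj⟩ := hCsucc _ hpC
      exact hKorb j hj1 (by omega) (h.injective (h.injective hj) ▸ hp))
    ⟨_, ⟨z, hzK, rfl⟩, rfl⟩ ⟨_, ⟨x, hxK, rfl⟩, rfl⟩
  have hiter : ∀ j, 1 ≤ j → j < n → (⇑((h.trans φ).trans ψ))^[j] x = (⇑h)^[j + 1] x := by
    intro j hj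
    induction j, hj using Nat.le_induction with
    | base => intro _; simp [hφx, hψx]
    | succ j hj ih =>
      intro hjn
      have hmem : (⇑h)^[j + 1 + 1] x ∈ C := ⟨j + 1 + 1, ⟨by omega, by omega⟩, rfl⟩
      rw [Function.iterate_succ_apply', ih (by omega), Homeomorph.trans_apply,
        Homeomorph.trans_apply, ← Function.iterate_succ_apply' h, hφC _ (Or.inr hmem),
        hψC _ hmem]
  refine hno ⟨n - 1, by omega, by omega, _, hψ, hψfix, x, ?_⟩
  rw [hiter (n - 1) (by omega) (by omega), Nat.sub_add_cancel (by omega), hx]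

theorem not_hasFreePeriodicMap (n : ℕ) (hn : 1 ≤ n) : ¬ HasFreePeriodicMap n := by
  induction n using Nat.strong_induction_on with
  | _ n ih =>
    intro hP
    rcases le_or_gt 3 n with h3 | h3
    · obtain ⟨m, hm, hmn, hPm⟩ := hP.exists_lt h3
      exact ih m hmn hm hPm
    · obtain ⟨h, hor, hfix, x, hx⟩ := hP
      interval_cases n
      · exact hfix x hx
      · exact apply_apply_ne_of_fixed_point_free hor hfix x hx

/-- A fixed point free orientation preserving homeomorphism of the plane has no periodic
points. -/
theorem no_periodic_points_of_fixed_point_free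
    (h : ℂ ≃ₜ ℂ) (hor : OrientationPreserving h) (hfix : ∀ x : ℂ, h x ≠ x) :
    ∀ (x : ℂ) (n : ℕ), 1 ≤ n → (⇑h)^[n] x ≠ x :=
  fun x n hn hx => not_hasFreePeriodicMap n hn ⟨h, hor, hfix, x, hx⟩
end

section
/- Let α : [a,b] → ℝ² be an arc and let f, g : Im α → ℝ² be continuous maps without fixed points on Im α such that f(α(a)) = g(α(a)) and f(α(b)) = g(α(b)). Suppose L is a closed half-line from one endpoint of α to infinity meeting Im α only in that endpoint, and the images of f and g lie inside ℝ² ∖ (L ∪ Im α). Then i(f, α) − i(g, α) = 0. -/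
open Set

/-- Two continuous logarithms of the same function on a connected space differ by a constant. -/
theorem sub_eq_sub_of_exp_comp_eq {X : Type*} [TopologicalSpace X] [PreconnectedSpace X]
    {D₁ D₂ : X → ℂ} (h₁ : Continuous D₁) (h₂ : Continuous D₂)
    (h : ∀ x, Complex.exp (D₁ x) = Complex.exp (D₂ x)) (x y : X) :
    D₁ x - D₁ y = D₂ x - D₂ y := by
  have key : D₁ = fun z => D₂ z + (D₁ y - D₂ y) := by
    refine Complex.isCoveringMap_exp.eq_of_comp_eq h₁ (by fun_prop) ?_ y (by ring)
    funext z
    simp [Complex.exp_add, Complex.exp_sub, h]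
  rw [congrFun key x]
  ring

/-- A nowhere vanishing continuous function on the plane has a continuous logarithm. -/
theorem exists_continuous_log_s6 (h : ℝ × ℝ → ℂ) (hc : Continuous h) (h0 : ∀ x, h x ≠ 0) :
    ∃ E : ℝ × ℝ → ℂ, Continuous E ∧ ∀ x, Complex.exp (E x) = h x := by
  obtain ⟨E, ⟨-, hE⟩, -⟩ := Complex.isCoveringMapOn_exp.existsUnique_continuousMap_lifts
    ⟨h, hc⟩ (a₀ := (0 : ℝ × ℝ)) (e₀ := Complex.log (h 0)) (Complex.exp_log (h0 0)) h0
  exact ⟨E, E.continuous, fun x => congrFun hE x⟩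

theorem div_neg_mem_slitPlane {z v : ℂ} (hv : v ≠ 0) (hz : ∀ r : ℝ, 0 ≤ r → z ≠ r * v) :
    z / -v ∈ Complex.slitPlane := by
  rw [Complex.mem_slitPlane_iff_not_le_zero, Complex.le_def]
  rintro ⟨h₁, h₂⟩
  refine hz (-(z / -v).re) (by simpa using h₁) ?_
  have : ((z / -v).re : ℂ) = z / -v := Complex.ext rfl h₂.symm
  rw [Complex.ofReal_neg, this]
  field_simp

/-- Two paths off a half-line from `p` with common endpoints have the same argument change
around `p`: a continuous logarithm of the quotient of their displacements from `p` returns to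
its initial value. -/
theorem log_div_endpoints_eq {u w : ℝ → ℂ} (hu : Continuous u) (hw : Continuous w)
    {a b : ℝ} (ha : u a = w a) (hb : u b = w b) {p v : ℂ} (hv : v ≠ 0)
    (hup : ∀ t, ∀ r : ℝ, 0 ≤ r → u t - p ≠ r * v)
    (hwp : ∀ t, ∀ r : ℝ, 0 ≤ r → w t - p ≠ r * v)
    {E : ℝ → ℂ} (hE : Continuous E)
    (h : ∀ t, Complex.exp (E t) = (u t - p) / (w t - p)) : E a = E b := by
  have hu' t := div_neg_mem_slitPlane hv (hup t)
  have hw' t := div_neg_mem_slitPlane hv (hwp t)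
  have key := sub_eq_sub_of_exp_comp_eq
    (D₂ := fun t => Complex.log ((u t - p) / -v) - Complex.log ((w t - p) / -v)) hE
    (((hu.sub continuous_const).div_const _).clog hu' |>.sub
      (((hw.sub continuous_const).div_const _).clog hw')) (fun t => by
        rw [Complex.exp_sub, Complex.exp_log (Complex.slitPlane_ne_zero (hu' t)),
          Complex.exp_log (Complex.slitPlane_ne_zero (hw' t)), h,
          div_div_div_cancel_right₀ (neg_ne_zero.2 hv)]) a b
  simpa [ha, hb, sub_eq_zero] using key

theorem exists_log_div_endpoints_eq {β u w : ℝ → ℂ} (hβ : Continuous β) (hu : Continuous u)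
    (hw : Continuous w) (huβ : ∀ t s, u t ≠ β s) (hwβ : ∀ t s, w t ≠ β s)
    {a b : ℝ} (ha : u a = w a) (hb : u b = w b) {p v : ℂ} (hp : p = β a ∨ p = β b) (hv : v ≠ 0)
    (hup : ∀ t, ∀ r : ℝ, 0 ≤ r → u t - p ≠ r * v)
    (hwp : ∀ t, ∀ r : ℝ, 0 ≤ r → w t - p ≠ r * v) :
    ∃ D : ℝ → ℂ, Continuous D ∧
      (∀ t, Complex.exp (D t) = (u t - β t) / (w t - β t)) ∧ D a = D b := by
  obtain ⟨E, hE, hexp⟩ := exists_continuous_log_s6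
    (fun x => (u x.1 - β x.2) / (w x.1 - β x.2))
    (Continuous.div (by fun_prop) (by fun_prop) fun x => sub_ne_zero.2 (hwβ _ _))
    (fun x => div_ne_zero (sub_ne_zero.2 (huβ _ _)) (sub_ne_zero.2 (hwβ _ _)))
  refine ⟨fun t => E (t, t), by fun_prop, fun t => hexp (t, t), ?_⟩
  have vert (c : ℝ) (hc : u c = w c) : E (c, a) = E (c, b) := by
    refine sub_eq_zero.1 ((sub_eq_sub_of_exp_comp_eq (D₁ := fun s => E (c, s))
      (D₂ := fun _ => 0) (by fun_prop) continuous_const (fun s => ?_) a b).trans (sub_self 0))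
    rw [hexp, hc, div_self (sub_ne_zero.2 (hwβ _ _)), Complex.exp_zero]
  have horiz (c : ℝ) (hc : p = β c) : E (a, c) = E (b, c) :=
    log_div_endpoints_eq (E := fun t => E (t, c)) hu hw ha hb hv hup hwp (by fun_prop)
      (fun t => by rw [hexp, hc])
  rcases hp with hp | hp
  · exact (horiz a hp).trans (vert b hb)
  · exact (vert a ha).trans (horiz b hp)

/-- If `f` and `g` agree at the endpoints of an arc `α` and both have images avoiding
`L ∪ Im α`, where `L` is a half-line from an endpoint of `α` to infinity meeting `Im α`
only in that endpoint, then `i(f, α) - i(g, α) = 0`. -/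
theorem index_diff_zero_of_images_avoiding_halfline
    (α : ℝ → ℂ) (a b : ℝ) (hα : IsArcOn α a b)
    (f g : ℂ → ℂ)
    (hf : ContinuousOn f (α '' Set.Icc a b)) (hg : ContinuousOn g (α '' Set.Icc a b))
    (hffix : ∀ z ∈ α '' Set.Icc a b, f z ≠ z) (hgfix : ∀ z ∈ α '' Set.Icc a b, g z ≠ z)
    (hfa : f (α a) = g (α a)) (hfb : f (α b) = g (α b))
    (p : ℂ) (hp : p = α a ∨ p = α b)
    (v : ℂ) (hv : v ≠ 0)
    (L : Set ℂ) (hL : L = {z : ℂ | ∃ t : ℝ, 0 ≤ t ∧ z = p + (t : ℂ) * v})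
    (hLα : L ∩ α '' Set.Icc a b = {p})
    (hfim : f '' (α '' Set.Icc a b) ⊆ (L ∪ α '' Set.Icc a b)ᶜ)
    (hgim : g '' (α '' Set.Icc a b) ⊆ (L ∪ α '' Set.Icc a b)ᶜ) :
    ∀ θf θg : ℝ → ℝ,
      IsArgLift (fun t => f (α t) - α t) a b θf →
      IsArgLift (fun t => g (α t) - α t) a b θg →
      (θf b - θf a) - (θg b - θg a) = 0 := by
  intro θf θg ⟨hθf, hθf'⟩ ⟨hθg, hθg'⟩
  obtain ⟨hab, hαc, -⟩ := hα
  have hab' := hab.le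
  set c : ℝ → ℝ := fun t => projIcc a b hab' t with hc_def
  have hc : Continuous c := continuous_subtype_val.comp continuous_projIcc
  have hmem t : c t ∈ Icc a b := (projIcc a b hab' t).2
  have hca : c a = a := by simp [hc_def]
  have hcb : c b = b := by simp [hc_def]
  have hβ : Continuous fun t => α (c t) := hαc.comp_continuous hc hmem
  have hβmem t : α (c t) ∈ α '' Icc a b := mem_image_of_mem _ (hmem t)
  have avoid (k : ℂ → ℂ) (hk : k '' (α '' Icc a b) ⊆ (L ∪ α '' Icc a b)ᶜ) (t : ℝ) :
      (∀ s, k (α (c t)) ≠ α (c s)) ∧ ∀ r : ℝ, 0 ≤ r → k (α (c t)) - p ≠ r * v := by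
    have := hk (mem_image_of_mem k (hβmem t))
    rw [mem_compl_iff, mem_union, not_or] at this
    refine ⟨fun s hs => this.2 (hs ▸ hβmem s), fun r hr h => this.1 ?_⟩
    rw [hL]
    exact ⟨r, hr, by rw [← h]; ring⟩
  obtain ⟨D, hD, hexp, hDab⟩ := exists_log_div_endpoints_eq (a := a) (b := b)
    (u := fun t => f (α (c t))) (w := fun t => g (α (c t))) hβ
    (hf.comp_continuous hβ hβmem) (hg.comp_continuous hβ hβmem)
    (fun t => (avoid f hfim t).1) (fun t => (avoid g hgim t).1)
    (by simpa only [hca] using hfa) (by simpa only [hcb] using hfb)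
    (p := p) (v := v) (by simpa only [hca, hcb] using hp) hv
    (fun t => (avoid f hfim t).2) (fun t => (avoid g hgim t).2)
  have hf0 t : f (α (c t)) - α (c t) ≠ 0 := sub_ne_zero.2 (hffix _ (hβmem t))
  have hg0 t : g (α (c t)) - α (c t) ≠ 0 := sub_ne_zero.2 (hgfix _ (hβmem t))
  have hlog (k : ℂ → ℂ) (θ : ℝ → ℝ) (hk : ContinuousOn k (α '' Icc a b))
      (hk0 : ∀ t, k (α (c t)) - α (c t) ≠ 0) (hθ : ContinuousOn θ (Icc a b)) :
      Continuous fun t => ((Real.log ‖k (α (c t)) - α (c t)‖ : ℝ) : ℂ) +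
        2 * Real.pi * Complex.I * θ (c t) :=
    (Complex.continuous_ofReal.comp ((((hk.comp_continuous hβ hβmem).sub hβ).norm).log
      fun t => norm_ne_zero_iff.2 (hk0 t))).add
      (continuous_const.mul (Complex.continuous_ofReal.comp (hθ.comp_continuous hc hmem)))
  have hlift (k : ℂ → ℂ) (θ : ℝ → ℝ)
      (hk0 : ∀ t, k (α (c t)) - α (c t) ≠ 0)
      (hθ : ∀ t ∈ Icc a b, k (α t) - α t =
        (‖k (α t) - α t‖ : ℂ) * Complex.exp (2 * Real.pi * Complex.I * θ t)) (t : ℝ) :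
      Complex.exp ((Real.log ‖k (α (c t)) - α (c t)‖ : ℝ) + 2 * Real.pi * Complex.I * θ (c t))
        = k (α (c t)) - α (c t) := by
    rw [Complex.exp_add, ← Complex.ofReal_exp, Real.exp_log (norm_pos_iff.2 (hk0 t)),
      ← hθ _ (hmem t)]
  have key := sub_eq_sub_of_exp_comp_eq hD
    (D₂ := fun t =>
      ((Real.log ‖f (α (c t)) - α (c t)‖ : ℝ) + 2 * Real.pi * Complex.I * θf (c t)) -
      ((Real.log ‖g (α (c t)) - α (c t)‖ : ℝ) + 2 * Real.pi * Complex.I * θg (c t)))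
    ((hlog f θf hf hf0 hθf).sub (hlog g θg hg hg0 hθg))
    (fun t => by rw [hexp, Complex.exp_sub, hlift f θf hf0 hθf', hlift g θg hg0 hθg']) b a
  have him := congrArg Complex.im key
  simp [hca, hcb, hfa, hfb, hDab] at him
  have hpi := Real.pi_pos
  have : 2 * Real.pi * ((θf b - θf a) - (θg b - θg a)) = 0 := by linarith
  simpa [hpi.ne'] using this
end

section
/- Let α : [a,b] → ℝ² be an arc and let f, g : Im α → ℝ² be continuous maps without fixed points on Im α such that f(α(a)) = g(α(a)) and f(α(b)) = g(α(b)). Suppose the images of f ∘ α and g ∘ α together form a Jordan curve 𝒞, that Im α is contained in the bounded component int 𝒞 of ℝ² ∖ 𝒞, and that the orientation of 𝒞 induced by f (from f(α(a)) to f(α(b))) is positive. Then i(f, α) − i(g, α) = 1. -/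
open Set

/-- A continuous integer-valued function on a preconnected set is constant. -/
lemma eq_of_forall_eq_intCast {X : Type*} [TopologicalSpace X] {S : Set X} (hS : IsPreconnected S)
    {φ : X → ℝ} (hφ : ContinuousOn φ S) (hint : ∀ x ∈ S, ∃ n : ℤ, φ x = n) {x y : X}
    (hx : x ∈ S) (hy : y ∈ S) : φ x = φ y := by
  have : DiscreteTopology (Set.range ((↑) : ℤ → ℝ)) :=
    Int.isClosedEmbedding_coe_real.isEmbedding.toHomeomorph.symm.isEmbedding.discreteTopology
  exact hS.constant_of_mapsTo (T := Set.range ((↑) : ℤ → ℝ)) ⟨this⟩ hφ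
    (fun z hz => (hint z hz).imp fun _ h => h.symm) hx hy

/-- Two arguments of the same nonzero number differ by an integer number of turns. -/
lemma exists_int_sub_eq_of_polar {z : ℂ} (hz : z ≠ 0) {x y : ℝ}
    (hx : z = (‖z‖ : ℂ) * Complex.exp (2 * Real.pi * Complex.I * x))
    (hy : z = (‖z‖ : ℂ) * Complex.exp (2 * Real.pi * Complex.I * y)) :
    ∃ n : ℤ, x - y = n := by
  have hn : (‖z‖ : ℂ) ≠ 0 := by simpa using hz
  obtain ⟨n, h⟩ := Complex.exp_eq_exp_iff_exists_int.1 (mul_left_cancel₀ hn (hx.symm.trans hy))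
  refine ⟨n, ?_⟩
  have h' : (2 * Real.pi * Complex.I) * (x : ℂ) = (2 * Real.pi * Complex.I) * (y + n : ℂ) := by
    rw [h]; ring
  have h'' := mul_left_cancel₀ Complex.two_pi_I_ne_zero h'
  have : x = y + n := by exact_mod_cast h''
  linarith

/-- The total variation of the argument does not depend on the lift. -/
lemma IsArgLift.sub_eq_sub {v : ℝ → ℂ} {a b : ℝ} (hab : a ≤ b) {θ θ' : ℝ → ℝ}
    (h : IsArgLift v a b θ) (h' : IsArgLift v a b θ') (hv : ∀ t ∈ Icc a b, v t ≠ 0) :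
    θ b - θ a = θ' b - θ' a := by
  have := eq_of_forall_eq_intCast isPreconnected_Icc (h.1.sub h'.1)
    (fun t ht => exists_int_sub_eq_of_polar (hv t ht) (h.2 t ht) (h'.2 t ht))
    (right_mem_Icc.2 hab) (left_mem_Icc.2 hab)
  simp only [Pi.sub_apply] at this
  linarith

/-- A nonvanishing complex function on a simply connected space has a continuous argument. -/
lemma exists_continuous_arg {X : Type*} [TopologicalSpace X] [SimplyConnectedSpace X]
    [LocallyPathConnectedSpace X] {V : X → ℂ} (hV : Continuous V) (hV0 : ∀ x, V x ≠ 0) :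
    ∃ Θ : X → ℝ, Continuous Θ ∧
      ∀ x, V x = (‖V x‖ : ℂ) * Complex.exp (2 * Real.pi * Complex.I * Θ x) := by
  obtain ⟨x₀⟩ : Nonempty X := inferInstance
  obtain ⟨F, ⟨-, hF⟩, -⟩ := Complex.isCoveringMapOn_exp.existsUnique_continuousMap_lifts
    ⟨V, hV⟩ (a₀ := x₀) (e₀ := Complex.log (V x₀)) (Complex.exp_log (hV0 x₀)) (fun x => hV0 x)
  refine ⟨fun x => (F x).im / (2 * Real.pi), by fun_prop, fun x => ?_⟩
  have hx : Complex.exp (F x) = V x := congrFun hF x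
  have hpi : (Real.pi : ℂ) ≠ 0 := by exact_mod_cast Real.pi_ne_zero
  rw [← hx, Complex.norm_exp, Complex.ofReal_exp, ← Complex.exp_add]
  congr 1
  push_cast
  field_simp
  rw [mul_comm Complex.I, Complex.re_add_im]

/-- A homotopy of nonvanishing closed curves carries continuous arguments
whose total variation is the same for all curves. -/
lemma exists_argLift_homotopy {V : ℝ × ℝ → ℂ} (hV : Continuous V) (hV0 : ∀ p, V p ≠ 0) {a b : ℝ}
    (hclosed : ∀ s, V (s, a) = V (s, b)) :
    ∃ Θ : ℝ → ℝ → ℝ, (∀ s, IsArgLift (fun t => V (s, t)) a b (Θ s)) ∧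
      ∀ s s', Θ s b - Θ s a = Θ s' b - Θ s' a := by
  obtain ⟨Θ, hΘ, hVΘ⟩ := exists_continuous_arg hV hV0
  refine ⟨fun s t => Θ (s, t), fun s => ⟨by fun_prop, fun t _ => hVΘ (s, t)⟩, fun s s' => ?_⟩
  refine eq_of_forall_eq_intCast (φ := fun s => Θ (s, b) - Θ (s, a)) isPreconnected_univ
    (by fun_prop) (fun s _ => ?_) (mem_univ s) (mem_univ s')
  refine exists_int_sub_eq_of_polar (hV0 (s, b)) (hVΘ (s, b)) ?_
  rw [← hclosed]
  exact hVΘ (s, a)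

/-- If `f` and `g` agree at the endpoints of an arc `α` and their images along `α` together
form a positively oriented Jordan curve whose interior contains `Im α` (the curve being
traversed along `f` from `f(α a)` to `f(α b)` and back along `g`), then
`i(f, α) - i(g, α) = 1`. -/
theorem index_diff_one_of_images_forming_jordan_curve
    (α : ℝ → ℂ) (a b : ℝ) (hα : IsArcOn α a b)
    (f g : ℂ → ℂ)
    (hf : ContinuousOn f (α '' Set.Icc a b)) (hg : ContinuousOn g (α '' Set.Icc a b))
    (hffix : ∀ z ∈ α '' Set.Icc a b, f z ≠ z) (hgfix : ∀ z ∈ α '' Set.Icc a b, g z ≠ z)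
    (hfa : f (α a) = g (α a)) (hfb : f (α b) = g (α b))
    (δ : ℝ → ℂ) (hδ : δ = fun t => if t ≤ b then f (α t) else g (α (2 * b - t)))
    (hδscc : IsSimpleClosedCurve δ a (2 * b - a))
    (I : Set ℂ) (hI : IsInteriorOf (δ '' Set.Icc a (2 * b - a)) I)
    (hαI : α '' Set.Icc a b ⊆ I)
    (hpos : IsPositivelyOriented δ a (2 * b - a)) :
    ∀ θf θg : ℝ → ℝ,
      IsArgLift (fun t => f (α t) - α t) a b θf →
      IsArgLift (fun t => g (α t) - α t) a b θg →
      (θf b - θf a) - (θg b - θg a) = 1 := by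
  intro θf θg hθf hθg
  obtain ⟨hab, hαc, -⟩ := hα
  obtain ⟨-, hδc, hδcl, -⟩ := hδscc
  have hab' : a ≤ 2 * b - a := by linarith
  have hdisj : ∀ t ∈ Icc a (2 * b - a), ∀ u ∈ Icc a b, δ t - α u ≠ 0 := by
    intro t ht u hu h
    obtain ⟨-, x, hx, rfl⟩ := hI
    refine connectedComponentIn_subset _ _ (hαI (mem_image_of_mem α hu)) ?_
    rw [← sub_eq_zero.1 h]
    exact mem_image_of_mem δ ht
  let p : ℝ → ℝ := fun t => projIcc a (2 * b - a) hab' t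
  let q : ℝ → ℝ := fun s => projIcc (0 : ℝ) 1 zero_le_one s
  have hp : Continuous p := by fun_prop
  have hq : Continuous q := by fun_prop
  have hpm : ∀ t, p t ∈ Icc a (2 * b - a) := fun t => (projIcc a (2 * b - a) hab' t).2
  have hqm : ∀ s, q s ∈ Icc (0 : ℝ) 1 := fun s => (projIcc (0 : ℝ) 1 zero_le_one s).2
  have hpe : ∀ t ∈ Icc a (2 * b - a), p t = t := fun t ht => by simp [p, projIcc_of_mem _ ht]
  let r : ℝ × ℝ → ℝ := fun z => a + q z.1 * (min (p z.2) (2 * b - p z.2) - a)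
  have hr : Continuous r := by fun_prop
  have hrm : ∀ z, r z ∈ Icc a b := by
    intro z
    have h1 : a ≤ min (p z.2) (2 * b - p z.2) :=
      le_min (hpm _).1 (by linarith [(hpm z.2).2])
    have h2 : min (p z.2) (2 * b - p z.2) ≤ b := by
      rcases le_total (p z.2) b with h | h
      · exact (min_le_left _ _).trans h
      · exact (min_le_right _ _).trans (by linarith)
    have h3 := hqm z.1
    constructor
    · exact le_add_of_nonneg_right (mul_nonneg h3.1 (by linarith))
    · have := mul_le_of_le_one_left (sub_nonneg.2 h1) h3.2
      simp only [r]
      linarith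
  let V : ℝ × ℝ → ℂ := fun z => δ (p z.2) - α (r z)
  have hV : Continuous V :=
    (hδc.comp_continuous (hp.comp continuous_snd) fun z => hpm z.2).sub (hαc.comp_continuous hr hrm)
  have hV0 : ∀ z, V z ≠ 0 := fun z => hdisj _ (hpm z.2) _ (hrm z)
  have hVcl : ∀ s, V (s, a) = V (s, 2 * b - a) := by
    intro s
    simp only [V, r, hpe a (left_mem_Icc.2 hab'), hpe _ (right_mem_Icc.2 hab'), hδcl]
    rw [min_comm, sub_sub_cancel]
  obtain ⟨Θ, hΘ, hΘeq⟩ := exists_argLift_homotopy hV hV0 hVcl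
  have h0 : Θ 0 (2 * b - a) - Θ 0 a = 1 := by
    refine hpos I hI (α a) (hαI (mem_image_of_mem α (left_mem_Icc.2 hab.le))) _
      ⟨(hΘ 0).1, fun t ht => ?_⟩
    have hVt : V (0, t) = δ t - α a := by simp [V, r, q, hpe t ht]
    simpa only [hVt] using (hΘ 0).2 t ht
  have hq1 : q 1 = 1 := by simp [q]
  have hVf : ∀ t ∈ Icc a b, V (1, t) = f (α t) - α t := by
    intro t ht
    have ht' : t ∈ Icc a (2 * b - a) := ⟨ht.1, by linarith [ht.2]⟩
    have hmin : min t (2 * b - t) = t := min_eq_left (by linarith [ht.2])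
    simp [V, r, hq1, hpe t ht', hmin, hδ, ht.2]
  have hVg : ∀ t ∈ Icc a b, V (1, 2 * b - t) = g (α t) - α t := by
    intro t ht
    have ht' : 2 * b - t ∈ Icc a (2 * b - a) := ⟨by linarith [ht.1, ht.2], by linarith [ht.1]⟩
    have hmin : min (2 * b - t) t = t := min_eq_right (by linarith [ht.2])
    have hδt : δ (2 * b - t) = g (α t) := by
      rcases ht.2.eq_or_lt with rfl | h
      · simp [hδ, two_mul, hfb]
      · have : ¬ 2 * b - t ≤ b := by linarith
        simp [hδ, this]
    simp [V, r, hq1, hpe _ ht', hmin, hδt]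
  have hf1 : Θ 1 b - Θ 1 a = θf b - θf a := by
    refine IsArgLift.sub_eq_sub hab.le ⟨?_, fun t ht => ?_⟩ hθf
      fun t ht => sub_ne_zero.2 (hffix _ (mem_image_of_mem α ht))
    · exact (hΘ 1).1.mono (Icc_subset_Icc_right (by linarith))
    · simpa only [hVf t ht] using (hΘ 1).2 t ⟨ht.1, by linarith [ht.2]⟩
  have hg1 : Θ 1 (2 * b - b) - Θ 1 (2 * b - a) = θg b - θg a := by
    have hmaps : ∀ t ∈ Icc a b, 2 * b - t ∈ Icc a (2 * b - a) := fun t ht =>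
      ⟨by linarith [ht.1, ht.2], by linarith [ht.1]⟩
    refine IsArgLift.sub_eq_sub (θ := fun t => Θ 1 (2 * b - t)) hab.le ⟨?_, fun t ht => ?_⟩ hθg
      fun t ht => sub_ne_zero.2 (hgfix _ (mem_image_of_mem α ht))
    · exact (hΘ 1).1.comp (by fun_prop) hmaps
    · simpa only [hVg t ht] using (hΘ 1).2 _ (hmaps t ht)
  rw [show 2 * b - b = b by ring] at hg1
  linarith [hΘeq 0 1]
end

section
/- Every closed, compactly connected subset F of ℝ² can be written as an increasing union of subcontinua: there exist continua K₁ ⊂ K₂ ⊂ ⋯ contained in F with F = ⋃ₙ Kₙ. -/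
open Set

theorem isClosed_connectedComponentIn {X : Type*} [TopologicalSpace X] {F : Set X}
    (hF : IsClosed F) (x : X) : IsClosed (connectedComponentIn F x) := by
  by_cases hx : x ∈ F
  · exact isClosed_of_closure_subset
      (isPreconnected_connectedComponentIn.closure.subset_connectedComponentIn
        (subset_closure (mem_connectedComponentIn hx))
        (closure_minimal (connectedComponentIn_subset F x) hF))
  · rw [connectedComponentIn_eq_empty hx]
    exact isClosed_empty

/-- **Lemma 5.5.** A (non-empty) closed, compactly connected subset of the plane is an
increasing union of subcontinua. -/
theorem compactly_connected_is_increasing_union_of_continua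
    (F : Set ℂ) (hFne : F.Nonempty) (hFcl : IsClosed F) (hFcc : CompactlyConnected F) :
    ∃ K : ℕ → Set ℂ,
      (∀ n, K n ⊆ F ∧ IsCompact (K n) ∧ IsConnected (K n)) ∧
      (∀ n, K n ⊆ K (n + 1)) ∧
      F = ⋃ n, K n := by
  obtain ⟨x, hx⟩ := hFne
  have hmem : ∀ n : ℕ, x ∈ F ∩ Metric.closedBall x n := fun n =>
    ⟨hx, Metric.mem_closedBall_self n.cast_nonneg⟩
  refine ⟨fun n => connectedComponentIn (F ∩ Metric.closedBall x n) x, fun n => ⟨?_, ?_, ?_⟩,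
    fun n => ?_, ?_⟩
  · exact (connectedComponentIn_subset _ _).trans inter_subset_left
  · have hcl : IsClosed (F ∩ Metric.closedBall x n) := hFcl.inter Metric.isClosed_closedBall
    exact ((isCompact_closedBall x (n : ℝ)).of_isClosed_subset hcl
      inter_subset_right).of_isClosed_subset (isClosed_connectedComponentIn hcl x)
      (connectedComponentIn_subset _ _)
  · exact isConnected_connectedComponentIn_iff.mpr (hmem n)
  · exact connectedComponentIn_mono x (inter_subset_inter_right F
      (Metric.closedBall_subset_closedBall (by norm_num)))
  · refine Subset.antisymm (fun y hy => ?_) (iUnion_subset fun n =>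
      (connectedComponentIn_subset _ _).trans inter_subset_left)
    obtain ⟨K, hKF, hxK, hyK, hKc, hK⟩ := hFcc x hx y hy
    obtain ⟨r, hr⟩ := hKc.isBounded.subset_closedBall x
    obtain ⟨n, hn⟩ := exists_nat_ge r
    exact mem_iUnion.mpr ⟨n, hK.isPreconnected.subset_connectedComponentIn hxK
      (subset_inter hKF (hr.trans (Metric.closedBall_subset_closedBall hn))) hyK⟩
end

section
/- Let α : [a,b] → ℝ² be a closed curve (α(a) = α(b)), let f : Im α → ℝ² be a continuous map without fixed points on Im α, and let g be an orientation preserving homeomorphism of ℝ². Then i(g ∘ f ∘ g⁻¹, g ∘ α) = i(f, α). -/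
open Set

/-- A continuous nowhere vanishing function on a simply connected, locally path connected space
has a continuous logarithm. -/
theorem exists_continuous_exp_eq {A : Type*} [TopologicalSpace A] [SimplyConnectedSpace A]
    [LocallyPathConnectedSpace A] {F : A → ℂ} (hF : Continuous F) (hF0 : ∀ x, F x ≠ 0) :
    ∃ L : A → ℂ, Continuous L ∧ ∀ x, Complex.exp (L x) = F x := by
  obtain ⟨x₀⟩ : Nonempty A := inferInstance
  obtain ⟨L, ⟨-, hL⟩, -⟩ := Complex.isCoveringMap_exp.existsUnique_continuousMap_lifts
    (⟨fun x => ⟨F x, hF0 x⟩, hF.subtype_mk _⟩ : C(A, {z : ℂ // z ≠ 0})) x₀ (Complex.log (F x₀))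
    (Subtype.ext (Complex.exp_log (hF0 x₀)))
  exact ⟨L, L.continuous, fun x => congrArg Subtype.val (congrFun hL x)⟩

/-- A continuous integer-valued function on an interval takes the same value at both ends. -/
theorem ContinuousOn.eq_endpoints_of_int_valued {h : ℝ → ℝ} {a b : ℝ} (hab : a ≤ b)
    (hc : ContinuousOn h (Set.Icc a b)) (hint : ∀ t ∈ Set.Icc a b, ∃ n : ℤ, h t = n) :
    h a = h b := by
  refine isPreconnected_Icc.constant_of_mapsTo (T := Set.range ((↑) : ℤ → ℝ)) ?_ hc
    (fun t ht => ?_) (left_mem_Icc.2 hab) (right_mem_Icc.2 hab)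
  · exact Int.isClosedEmbedding_coe_real.isInducing.isDiscrete_range
  · obtain ⟨n, hn⟩ := hint t ht
    exact ⟨n, hn.symm⟩

/-- Two logarithms of the same number have imaginary parts that differ by a multiple of `2π`. -/
theorem Complex.exists_int_im_sub_im_eq {z w : ℂ} (h : Complex.exp z = Complex.exp w) :
    ∃ n : ℤ, (z.im - w.im) / (2 * Real.pi) = n := by
  obtain ⟨n, rfl⟩ := Complex.exp_eq_exp_iff_exists_int.1 h
  refine ⟨n, ?_⟩
  simp

/-- The variation of an argument lift is computed by any continuous logarithm. -/
theorem IsArgLift.sub_eq_of_exp_eq {v : ℝ → ℂ} {a b : ℝ} {θ : ℝ → ℝ} (hab : a ≤ b)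
    (hθ : IsArgLift v a b θ) {L : ℝ → ℂ} (hL : ContinuousOn L (Set.Icc a b))
    (hLv : ∀ t ∈ Set.Icc a b, Complex.exp (L t) = v t) :
    θ b - θ a = ((L b).im - (L a).im) / (2 * Real.pi) := by
  have key := ContinuousOn.eq_endpoints_of_int_valued (h := fun t => (L t).im / (2 * Real.pi) - θ t)
    hab (((Complex.continuous_im.comp_continuousOn hL).div_const _).sub hθ.1) (fun t ht => by
      have hexp : Complex.exp (L t) =
          Complex.exp ((L t).re + 2 * Real.pi * Complex.I * θ t) := by
        rw [Complex.exp_add, ← Complex.ofReal_exp, ← Complex.norm_exp, hLv t ht]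
        exact hθ.2 t ht
      obtain ⟨n, hn⟩ := Complex.exists_int_im_sub_im_eq hexp
      refine ⟨n, hn ▸ ?_⟩
      have := Real.pi_ne_zero
      simp
      field_simp)
  rw [sub_div]
  linarith

/-- **Homotopy invariance of the winding number** for a homotopy of closed curves avoiding `0`. -/
theorem IsArgLift.sub_eq_of_homotopy {F : ℝ × ℝ → ℂ} (hF : Continuous F) (hF0 : ∀ p, F p ≠ 0)
    {a b : ℝ} (hab : a ≤ b) (hclosed : ∀ s, F (s, a) = F (s, b)) {c d : ℝ} (hcd : c ≤ d)
    {v w : ℝ → ℂ} (hv : ∀ t ∈ Set.Icc a b, F (c, t) = v t)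
    (hw : ∀ t ∈ Set.Icc a b, F (d, t) = w t) {θ θ' : ℝ → ℝ}
    (hθ : IsArgLift v a b θ) (hθ' : IsArgLift w a b θ') :
    θ b - θ a = θ' b - θ' a := by
  obtain ⟨L, hL, hLF⟩ := exists_continuous_exp_eq hF hF0
  rw [hθ.sub_eq_of_exp_eq hab (L := fun t => L (c, t)) (by fun_prop)
      (fun t ht => (hLF _).trans (hv t ht)),
    hθ'.sub_eq_of_exp_eq hab (L := fun t => L (d, t)) (by fun_prop)
      (fun t ht => (hLF _).trans (hw t ht))]
  exact ContinuousOn.eq_endpoints_of_int_valued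
    (h := fun s => ((L (s, b)).im - (L (s, a)).im) / (2 * Real.pi)) hcd
    (by fun_prop) fun s _ =>
      Complex.exists_int_im_sub_im_eq (by rw [hLF, hLF, hclosed])

/-- **Invariance of the index under orientation preserving conjugation (property 5 of the
index).** For a closed curve `α` and an orientation preserving homeomorphism `g` of the
plane, `i(g ∘ f ∘ g⁻¹, g ∘ α) = i(f, α)`. -/
theorem index_invariant_under_conjugation
    (α : ℝ → ℂ) (a b : ℝ) (hab : a < b)
    (hα : ContinuousOn α (Set.Icc a b)) (hclosed : α a = α b)
    (f : ℂ → ℂ) (hf : ContinuousOn f (α '' Set.Icc a b))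
    (hfix : ∀ z ∈ α '' Set.Icc a b, f z ≠ z)
    (g : ℂ ≃ₜ ℂ) (hg : OrientationPreserving g) :
    ∀ θ θ' : ℝ → ℝ,
      IsArgLift (fun t => (⇑g ∘ f ∘ ⇑g.symm) ((⇑g ∘ α) t) - (⇑g ∘ α) t) a b θ →
      IsArgLift (fun t => f (α t) - α t) a b θ' →
      θ b - θ a = θ' b - θ' a := by
  intro θ θ' hθ hθ'
  obtain ⟨H, hH, hHomeo, hH0, hH1⟩ := hg
  let p : ℝ → ℝ := fun t => projIcc a b hab.le t
  let q : ℝ → ℝ := fun s => projIcc 0 1 zero_le_one s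
  have hp : Continuous p := continuous_subtype_val.comp continuous_projIcc
  have hq : Continuous q := continuous_subtype_val.comp continuous_projIcc
  have hpmem : ∀ t, p t ∈ Set.Icc a b := fun t => Subtype.coe_prop _
  have hpt : ∀ t ∈ Set.Icc a b, p t = t := fun t ht => by simp [p, projIcc_of_mem hab.le ht]
  have hq0 : q 0 = 0 := by simp [q]
  have hq1 : q 1 = 1 := by simp [q]
  have hαp : Continuous fun t => α (p t) := hα.comp_continuous hp hpmem
  have hfαp : Continuous fun t => f (α (p t)) :=
    hf.comp_continuous hαp fun t => mem_image_of_mem α (hpmem t)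
  symm
  refine IsArgLift.sub_eq_of_homotopy
    (F := fun x => H (q x.1) (f (α (p x.2))) - H (q x.1) (α (p x.2)))
    ?_ (fun x => ?_) hab.le (fun s => ?_) zero_le_one (fun t ht => ?_) (fun t ht => ?_) hθ' hθ
  · exact (hH.comp ((hq.comp continuous_fst).prodMk (hfαp.comp continuous_snd))).sub
      (hH.comp ((hq.comp continuous_fst).prodMk (hαp.comp continuous_snd)))
  · exact sub_ne_zero.2 fun h => hfix _ (mem_image_of_mem α (hpmem x.2))
      ((hHomeo (q x.1) (Subtype.coe_prop _)).injective h)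
  · simp only [hpt a (left_mem_Icc.2 hab.le), hpt b (right_mem_Icc.2 hab.le), hclosed]
  · simp [hq0, hH0, hpt t ht]
  · simp [hq1, hH1, hpt t ht]
end
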